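/- The lifting map L is a bijection from the space of integrable measures on ℝⁿ onto the space ℳ_sym(S^n_0) of measures concentrated on S^n_0 = {u ∈ Sⁿ : u_0 ≠ 0} that are even under the reflection at the origin of ℝ^{n+1}. -/

import Mathlib

open MeasureTheory
open scoped ENNReal symmDiff Classical

noncomputable section

/-- The Euclidean (ℓ²) norm on `Fin n → ℝ`. -/
def e2 {n : ℕ} (x : Fin n → ℝ) : ℝ := Real.sqrt (∑ i, (x i) ^ 2)

/-- The unit sphere `S^{n-1}` in `ℝⁿ`. -/
def Sph (n : ℕ) : Set (Fin n → ℝ) := {x | e2 x = 1}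

/-- The set `A_E = {x : xᵢ ≠ 0 ↔ i ∈ E}`. -/
def setA {n : ℕ} (E : Finset (Fin n)) : Set (Fin n → ℝ) := {x | ∀ i, x i ≠ 0 ↔ i ∈ E}

/-- Finite signed Borel measures on `ℝⁿ`. -/
abbrev SM (n : ℕ) := MeasureTheory.SignedMeasure (Fin n → ℝ)

/-- A (finite) measure regarded as a signed measure (junk value `0` if not finite). -/
def toSigned {X : Type*} [MeasurableSpace X] (ρ : Measure X) : SignedMeasure X :=
  if h : IsFiniteMeasure ρ then @Measure.toSignedMeasure X _ ρ h else 0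

/-- Multiplicative convolution of two non-negative measures. -/
def mconvPos {n : ℕ} (ρ σ : Measure (Fin n → ℝ)) : Measure (Fin n → ℝ) :=
  (ρ.prod σ).map (fun p => p.1 * p.2)

/-- Multiplicative convolution `μ ⊛ ν` of two signed measures, via Jordan decomposition. -/
def mconv {n : ℕ} (μ ν : SM n) : SM n :=
  toSigned (mconvPos μ.toJordanDecomposition.posPart ν.toJordanDecomposition.posPart
      + mconvPos μ.toJordanDecomposition.negPart ν.toJordanDecomposition.negPart)
  - toSigned (mconvPos μ.toJordanDecomposition.posPart ν.toJordanDecomposition.negPart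
      + mconvPos μ.toJordanDecomposition.negPart ν.toJordanDecomposition.posPart)

/-- `μ` is integrable: `∫ ‖x‖₂ d|μ| < ∞`. -/
def IntegrableSM {n : ℕ} (μ : SM n) : Prop :=
  ∫⁻ x, ENNReal.ofReal (e2 x) ∂μ.totalVariation < ⊤

/-- `μ` is concentrated on `A`:  `|μ|(Aᶜ) = 0`. -/
def ConcOn {n : ℕ} (μ : SM n) (A : Set (Fin n → ℝ)) : Prop := μ.totalVariation Aᶜ = 0

/-- The multiple reflection `T_E` on `ℝⁿ`. -/
def flipE {n : ℕ} (E : Finset (Fin n)) (x : Fin n → ℝ) : Fin n → ℝ :=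
  fun i => if i ∈ E then -x i else x i

/-- Pushforward of a signed measure under `T_E`. -/
def Tmap {n : ℕ} (E : Finset (Fin n)) (μ : SM n) : SM n := μ.map (flipE E)

def EvenUnder {n : ℕ} (μ : SM n) (E : Finset (Fin n)) : Prop := Tmap E μ = μ
def OddUnder {n : ℕ} (μ : SM n) (E : Finset (Fin n)) : Prop := Tmap E μ = -μ

/-- Orthogonal projection onto the coordinate subspace `H_E`. -/
def projE {n : ℕ} (E : Finset (Fin n)) (x : Fin n → ℝ) : Fin n → ℝ :=
  fun i => if i ∈ E then x i else 0

/-- `P_E(μ)`: pushforward under `projE`. -/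
def Pmap {n : ℕ} (E : Finset (Fin n)) (μ : SM n) : SM n := μ.map (projE E)

/-- `R_E(μ) = μ_E`: restriction to `A_E`. -/
def Rres {n : ℕ} (E : Finset (Fin n)) (μ : SM n) : SM n := μ.restrict (setA E)

/-- Sign vector attached to `b : Fin n → Bool`. -/
def signVec {n : ℕ} (b : Fin n → Bool) : Fin n → ℝ := fun i => if b i then 1 else -1

/-- The measure `δ_J = 2^{-n} ∑_{s ∈ 𝒮ⁿ} σ_J(s) δ_s`. -/
def deltaJ {n : ℕ} (J : Finset (Fin n)) : SM n :=
  ((2 : ℝ) ^ n)⁻¹ •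
    ∑ b : Fin n → Bool,
      (∏ j ∈ J, (if b j then (1 : ℝ) else -1)) • toSigned (Measure.dirac (signVec b))

/-- `𝒥(E; Fe, Fo)`. -/
def JsetE {n : ℕ} (E : Finset (Fin n)) (Fe Fo : Set (Finset (Fin n))) :
    Set (Finset (Fin n)) :=
  {J | J ⊆ E ∧ (∀ F ∈ Fe, Even (J ∩ F).card) ∧ (∀ F ∈ Fo, Odd (J ∩ F).card)}

/-- `𝒥(Fe, Fo) = 𝒥([n]; Fe, Fo)`. -/
def Jset {n : ℕ} (Fe Fo : Set (Finset (Fin n))) : Set (Finset (Fin n)) :=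
  {J | (∀ F ∈ Fe, Even (J ∩ F).card) ∧ (∀ F ∈ Fo, Odd (J ∩ F).card)}

/-- `G` has a representation `G = F₁ Δ … Δ F_m` with each `Fᵢ` drawn from `Fe` or `Fo`,
in which the number of terms drawn from `Fo` is even (`odd = false`) or odd (`odd = true`). -/
def HasRep {n : ℕ} (Fe Fo : Set (Finset (Fin n))) (G : Finset (Fin n)) (odd : Bool) : Prop :=
  ∃ l : List (Finset (Fin n) × Bool),
    (∀ p ∈ l, if p.2 then p.1 ∈ Fo else p.1 ∈ Fe) ∧
    (l.map Prod.fst).foldr (· ∆ ·) ∅ = G ∧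
    (l.countP (fun p => p.2)) % 2 = (if odd then 1 else 0)

/-- The generating pair `(Fe, Fo)` is proper: the even and odd parts of the generated group
are disjoint. -/
def ProperPair {n : ℕ} (Fe Fo : Set (Finset (Fin n))) : Prop :=
  ∀ G : Finset (Fin n), ¬ (HasRep Fe Fo G false ∧ HasRep Fe Fo G true)

/-- `ℳ^int(A; Fe, Fo)`: integrable signed measures concentrated on `A`, even under `T_F`
for `F ∈ Fe` and odd under `T_F` for `F ∈ Fo`. -/
def MclassInt {n : ℕ} (A : Set (Fin n → ℝ)) (Fe Fo : Set (Finset (Fin n))) : Set (SM n) :=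
  {μ | IntegrableSM μ ∧ ConcOn μ A ∧ (∀ F ∈ Fe, EvenUnder μ F) ∧ (∀ F ∈ Fo, OddUnder μ F)}

/-- `ν` is universal on `𝒜`. -/
def Universal {n : ℕ} (ν : SM n) (𝒜 : Set (SM n)) : Prop :=
  ∀ μ ∈ 𝒜, mconv ν μ = 0 → μ = 0

/-- Radial projection of a non-negative measure. -/
def radPos {n : ℕ} (ρ : Measure (Fin n → ℝ)) : Measure (Fin n → ℝ) :=
  (ρ.withDensity fun x => ENNReal.ofReal (e2 x)).map (fun x => (e2 x)⁻¹ • x)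

/-- Radial projection `P_S` of a signed measure. -/
def PS {n : ℕ} (μ : SM n) : SM n :=
  toSigned (radPos μ.toJordanDecomposition.posPart) -
    toSigned (radPos μ.toJordanDecomposition.negPart)

/-- The spherical product `μ ⊛_S ν = P_S(μ ⊛ ν)`. -/
def mconvS {n : ℕ} (μ ν : SM n) : SM n := PS (mconv μ ν)

/-- `ν` is spherically universal on `𝒜`. -/
def SphUniversal {n : ℕ} (ν : SM n) (𝒜 : Set (SM n)) : Prop :=
  ∀ μ ∈ 𝒜, mconvS ν μ = 0 → μ = 0

/-- The unconditional symmetrisation `M_unc`. -/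
def Munc {n : ℕ} (μ : SM n) : SM n := ((2 : ℝ) ^ n)⁻¹ • ∑ E : Finset (Fin n), Tmap E μ

/-- Integral of `f` against a signed measure. -/
def sInt {n : ℕ} (μ : SM n) (f : (Fin n → ℝ) → ℝ) : ℝ :=
  (∫ x, f x ∂μ.toJordanDecomposition.posPart) - ∫ x, f x ∂μ.toJordanDecomposition.negPart

/-- `δ₁ ⊗ μ`: the lifting of `μ` to a measure on `ℝ^{n+1}`, with an extra `0`-th coordinate
carrying a unit atom at `1`. -/
def lift0 {n : ℕ} (μ : SM n) : SM (n + 1) := μ.map (fun x => Fin.cons 1 x)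

/-- Symmetrisation about the origin. -/
def Msym {n : ℕ} (μ : SM n) : SM n := (2 : ℝ)⁻¹ • (μ + μ.map (fun x => -x))

/-- The lifting `L(μ) = P_S(M_sym(δ₁ ⊗ μ))`. -/
def Lift {n : ℕ} (μ : SM n) : SM (n + 1) := PS (Msym (lift0 μ))

lemma toSigned_eq {X : Type*} [MeasurableSpace X] (ρ : Measure X) [h : IsFiniteMeasure ρ] :
    toSigned ρ = ρ.toSignedMeasure := dif_pos h

lemma toSigned_add {X : Type*} [MeasurableSpace X] (ρ σ : Measure X) [IsFiniteMeasure ρ]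
    [IsFiniteMeasure σ] : toSigned (ρ + σ) = toSigned ρ + toSigned σ := by
  simp only [toSigned_eq, Measure.toSignedMeasure_add]

lemma toSigned_sub_eq_toSigned_sub_iff {X : Type*} [MeasurableSpace X] {p q p' q' : Measure X}
    [IsFiniteMeasure p] [IsFiniteMeasure q] [IsFiniteMeasure p'] [IsFiniteMeasure q'] :
    toSigned p - toSigned q = toSigned p' - toSigned q' ↔ p + q' = p' + q := by
  rw [sub_eq_sub_iff_add_eq_add, ← toSigned_add, ← toSigned_add, toSigned_eq, toSigned_eq,
    Measure.toSignedMeasure_eq_toSignedMeasure_iff]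

lemma toSigned_map {X Y : Type*} [MeasurableSpace X] [MeasurableSpace Y] (p : Measure X)
    [IsFiniteMeasure p] {f : X → Y} (hf : Measurable f) :
    (toSigned p).map f = toSigned (p.map f) := by
  rw [toSigned_eq, toSigned_eq]
  ext s hs
  rw [VectorMeasure.map_apply _ hf hs, Measure.toSignedMeasure_apply_measurable (hf hs),
    Measure.toSignedMeasure_apply_measurable hs, measureReal_def, measureReal_def,
    Measure.map_apply hf hs]

lemma toSigned_sub_map {X Y : Type*} [MeasurableSpace X] [MeasurableSpace Y] (p q : Measure X)
    [IsFiniteMeasure p] [IsFiniteMeasure q] {f : X → Y} (hf : Measurable f) :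
    (toSigned p - toSigned q).map f = toSigned (p.map f) - toSigned (q.map f) := by
  rw [← toSigned_map p hf, ← toSigned_map q hf]
  ext s hs
  simp only [VectorMeasure.map_apply _ hf hs, _root_.sub_apply]

lemma toSigned_toJordanDecomposition {X : Type*} [MeasurableSpace X] (s : SignedMeasure X) :
    toSigned s.toJordanDecomposition.posPart - toSigned s.toJordanDecomposition.negPart = s := by
  rw [toSigned_eq, toSigned_eq]
  exact s.toSignedMeasure_toJordanDecomposition

lemma totalVariation_toSigned_sub_le {X : Type*} [MeasurableSpace X] (p q : Measure X)
    [IsFiniteMeasure p] [IsFiniteMeasure q] :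
    (toSigned p - toSigned q).totalVariation ≤ p + q := by
  rw [toSigned_eq, toSigned_eq, SignedMeasure.totalVariation,
    Measure.toJordanDecomposition_toSignedMeasure_sub]
  exact add_le_add Measure.sub_le Measure.sub_le

@[fun_prop]
lemma measurable_e2 {n : ℕ} : Measurable (e2 (n := n)) := by
  unfold e2; fun_prop

lemma measurable_cons_one {n : ℕ} :
    Measurable (fun x : Fin n → ℝ => (Fin.cons 1 x : Fin (n + 1) → ℝ)) := by
  refine measurable_pi_iff.2 fun i => ?_
  refine Fin.cases ?_ (fun j => ?_) i
  · simp
  · simpa using measurable_pi_apply j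

lemma e2_neg {n : ℕ} (x : Fin n → ℝ) : e2 (-x) = e2 x := by simp [e2]

lemma e2_nonneg {n : ℕ} (x : Fin n → ℝ) : 0 ≤ e2 x := Real.sqrt_nonneg _

lemma e2_smul {n : ℕ} (c : ℝ) (x : Fin n → ℝ) : e2 (c • x) = |c| * e2 x := by
  simp only [e2, Pi.smul_apply, smul_eq_mul, mul_pow, ← Finset.mul_sum]
  rw [Real.sqrt_mul (sq_nonneg c), Real.sqrt_sq_eq_abs]

lemma apply_le_e2 {n : ℕ} (x : Fin n → ℝ) (i : Fin n) : x i ≤ e2 x :=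
  Real.le_sqrt_of_sq_le (Finset.single_le_sum (f := fun i => x i ^ 2)
    (fun _ _ => sq_nonneg _) (Finset.mem_univ i))

lemma e2_cons_one {n : ℕ} (x : Fin n → ℝ) :
    e2 (Fin.cons 1 x : Fin (n + 1) → ℝ) = Real.sqrt (1 + e2 x ^ 2) := by
  have h : 0 ≤ ∑ i, x i ^ 2 := Finset.sum_nonneg fun _ _ => sq_nonneg _
  simp [e2, Fin.sum_univ_succ, Real.sq_sqrt h]

lemma e2_cons_one_pos {n : ℕ} (x : Fin n → ℝ) : 0 < e2 (Fin.cons 1 x : Fin (n + 1) → ℝ) := by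
  rw [e2_cons_one]; positivity

lemma e2_cons_one_le {n : ℕ} (x : Fin n → ℝ) :
    e2 (Fin.cons 1 x : Fin (n + 1) → ℝ) ≤ 1 + e2 x := by
  rw [e2_cons_one]
  exact Real.sqrt_le_iff.2 ⟨by linarith [e2_nonneg x], by nlinarith [e2_nonneg x]⟩

lemma e2_le_e2_cons_one {n : ℕ} (x : Fin n → ℝ) :
    e2 x ≤ e2 (Fin.cons 1 x : Fin (n + 1) → ℝ) := by
  rw [e2_cons_one]
  exact Real.le_sqrt_of_sq_le (by linarith)

/-- `∫ ‖x‖₂ dρ < ∞` for a non-negative measure `ρ`. -/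
def FiniteFirstMoment {n : ℕ} (ρ : Measure (Fin n → ℝ)) : Prop :=
  ∫⁻ x, ENNReal.ofReal (e2 x) ∂ρ < ⊤

lemma FiniteFirstMoment.mono {n : ℕ} {ρ σ : Measure (Fin n → ℝ)} (h : ρ ≤ σ)
    (hσ : FiniteFirstMoment σ) : FiniteFirstMoment ρ :=
  (lintegral_mono' h le_rfl).trans_lt hσ

lemma FiniteFirstMoment.add {n : ℕ} {ρ σ : Measure (Fin n → ℝ)}
    (hρ : FiniteFirstMoment ρ) (hσ : FiniteFirstMoment σ) : FiniteFirstMoment (ρ + σ) := by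
  rw [FiniteFirstMoment, lintegral_add_measure]
  exact ENNReal.add_lt_top.2 ⟨hρ, hσ⟩

lemma measurable_e2_inv_smul {n : ℕ} : Measurable (fun x : Fin n → ℝ => (e2 x)⁻¹ • x) :=
  measurable_e2.inv.smul measurable_id

lemma lintegral_radPos {n : ℕ} (ρ : Measure (Fin n → ℝ)) {f : (Fin n → ℝ) → ℝ≥0∞}
    (hf : Measurable f) :
    ∫⁻ x, f x ∂radPos ρ = ∫⁻ x, ENNReal.ofReal (e2 x) * f ((e2 x)⁻¹ • x) ∂ρ := by
  rw [radPos, lintegral_map hf measurable_e2_inv_smul]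
  exact lintegral_withDensity_eq_lintegral_mul _ measurable_e2.ennreal_ofReal
    (hf.comp measurable_e2_inv_smul)

lemma radPos_add {n : ℕ} (ρ σ : Measure (Fin n → ℝ)) :
    radPos (ρ + σ) = radPos ρ + radPos σ := by
  rw [radPos, withDensity_add_measure, Measure.map_add _ _ measurable_e2_inv_smul, radPos, radPos]

lemma FiniteFirstMoment.isFiniteMeasure_radPos {n : ℕ} {ρ : Measure (Fin n → ℝ)}
    (h : FiniteFirstMoment ρ) : IsFiniteMeasure (radPos ρ) := by
  constructor
  rw [← lintegral_one, lintegral_radPos _ measurable_const]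
  simpa [FiniteFirstMoment] using h

lemma PS_toSigned_sub {n : ℕ} {p q : Measure (Fin n → ℝ)} [IsFiniteMeasure p]
    [IsFiniteMeasure q] (hp : FiniteFirstMoment p) (hq : FiniteFirstMoment q) :
    PS (toSigned p - toSigned q) = toSigned (radPos p) - toSigned (radPos q) := by
  have hpq : (toSigned p - toSigned q).toJordanDecomposition =
      Measure.jordanDecompositionOfToSignedMeasureSub p q := by
    rw [toSigned_eq, toSigned_eq, Measure.toJordanDecomposition_toSignedMeasure_sub]
  have h := toSigned_toJordanDecomposition (toSigned p - toSigned q)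
  rw [PS]
  rw [hpq, Measure.jordanDecompositionOfToSignedMeasureSub_posPart,
    Measure.jordanDecompositionOfToSignedMeasureSub_negPart] at *
  have := hp.isFiniteMeasure_radPos
  have := hq.isFiniteMeasure_radPos
  have := (hp.mono (Measure.sub_le (ν := q))).isFiniteMeasure_radPos
  have := (hq.mono (Measure.sub_le (ν := p))).isFiniteMeasure_radPos
  rw [toSigned_sub_eq_toSigned_sub_iff] at h ⊢
  rw [← radPos_add, ← radPos_add, h]

/-- The symmetrisation `½(δ₁ ⊗ p + (-1)_*(δ₁ ⊗ p))` of the lift of a non-negative measure. -/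
def symLift {n : ℕ} (p : Measure (Fin n → ℝ)) : Measure (Fin (n + 1) → ℝ) :=
  (2⁻¹ : NNReal) • (p.map (fun x => Fin.cons 1 x) +
    (p.map (fun x => (Fin.cons 1 x : Fin (n + 1) → ℝ))).map (fun x => -x))

instance {n : ℕ} (p : Measure (Fin n → ℝ)) [IsFiniteMeasure p] : IsFiniteMeasure (symLift p) := by
  unfold symLift; infer_instance

lemma Msym_lift0_toSigned_sub {n : ℕ} (p q : Measure (Fin n → ℝ)) [IsFiniteMeasure p]
    [IsFiniteMeasure q] :
    Msym (lift0 (toSigned p - toSigned q)) = toSigned (symLift p) - toSigned (symLift q) := by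
  have hs : ∀ (ρ : Measure (Fin (n + 1) → ℝ)) [IsFiniteMeasure ρ],
      toSigned ((2⁻¹ : NNReal) • ρ) = (2 : ℝ)⁻¹ • toSigned ρ := fun ρ _ => by
    rw [toSigned_eq, toSigned_eq, Measure.toSignedMeasure_smul]
    ext s hs
    simp [NNReal.smul_def]
  rw [Msym, lift0, toSigned_sub_map _ _ measurable_cons_one,
    toSigned_sub_map _ _ (f := fun x => -x) measurable_neg,
    symLift, symLift, hs, hs, toSigned_add, toSigned_add]
  ext s -
  simp only [FunLike.coe_smul, FunLike.coe_add, _root_.sub_apply, Pi.smul_apply,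
    Pi.add_apply, smul_eq_mul]
  ring

lemma lintegral_symLift {n : ℕ} (p : Measure (Fin n → ℝ)) {f : (Fin (n + 1) → ℝ) → ℝ≥0∞}
    (hf : Measurable f) :
    ∫⁻ u, f u ∂symLift p =
      2⁻¹ * ∫⁻ x, (f (Fin.cons 1 x) + f (-(Fin.cons 1 x : Fin (n + 1) → ℝ))) ∂p := by
  have hf' : Measurable fun u => f (-u) := hf.comp measurable_neg
  rw [symLift, lintegral_smul_measure, lintegral_add_measure, lintegral_map hf measurable_neg,
    lintegral_map hf measurable_cons_one, lintegral_map hf' measurable_cons_one,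
    ENNReal.smul_def, smul_eq_mul, ← lintegral_add_left]
  · simp
  · exact hf.comp measurable_cons_one

lemma FiniteFirstMoment.symLift {n : ℕ} {p : Measure (Fin n → ℝ)} [IsFiniteMeasure p]
    (hp : FiniteFirstMoment p) : FiniteFirstMoment (symLift p) := by
  rw [FiniteFirstMoment, lintegral_symLift _ measurable_e2.ennreal_ofReal]
  have hle : ∫⁻ x, ENNReal.ofReal (e2 (Fin.cons 1 x : Fin (n + 1) → ℝ)) ∂p < ⊤ := by
    calc _ ≤ ∫⁻ x, (1 + ENNReal.ofReal (e2 x)) ∂p := lintegral_mono fun x => by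
          rw [← ENNReal.ofReal_one, ← ENNReal.ofReal_add zero_le_one (e2_nonneg x)]
          exact ENNReal.ofReal_le_ofReal (e2_cons_one_le x)
      _ < ⊤ := by
          rw [lintegral_add_left measurable_const]
          exact ENNReal.add_lt_top.2 ⟨by simp, hp⟩
  simp only [e2_neg]
  rw [lintegral_add_left]
  · exact ENNReal.mul_lt_top (by simp) (ENNReal.add_lt_top.2 ⟨hle, hle⟩)
  · exact measurable_e2.ennreal_ofReal.comp measurable_cons_one

/-- The lifting of a non-negative measure on `ℝⁿ`. -/
def liftPos {n : ℕ} (p : Measure (Fin n → ℝ)) : Measure (Fin (n + 1) → ℝ) := radPos (symLift p)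

lemma FiniteFirstMoment.isFiniteMeasure_liftPos {n : ℕ} {p : Measure (Fin n → ℝ)}
    [IsFiniteMeasure p] (hp : FiniteFirstMoment p) : IsFiniteMeasure (liftPos p) :=
  hp.symLift.isFiniteMeasure_radPos

lemma Lift_toSigned_sub {n : ℕ} {p q : Measure (Fin n → ℝ)} [IsFiniteMeasure p]
    [IsFiniteMeasure q] (hp : FiniteFirstMoment p) (hq : FiniteFirstMoment q) :
    Lift (toSigned p - toSigned q) = toSigned (liftPos p) - toSigned (liftPos q) := by
  rw [Lift, Msym_lift0_toSigned_sub, PS_toSigned_sub hp.symLift hq.symLift, liftPos, liftPos]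

/-- The point of the upper half-sphere above `x`. -/
def sphPoint {n : ℕ} (x : Fin n → ℝ) : Fin (n + 1) → ℝ :=
  (e2 (Fin.cons 1 x : Fin (n + 1) → ℝ))⁻¹ • (Fin.cons 1 x : Fin (n + 1) → ℝ)

@[fun_prop]
lemma measurable_sphPoint {n : ℕ} : Measurable (sphPoint (n := n)) :=
  measurable_e2_inv_smul.comp measurable_cons_one

lemma sphPoint_zero {n : ℕ} (x : Fin n → ℝ) :
    sphPoint x 0 = (e2 (Fin.cons 1 x : Fin (n + 1) → ℝ))⁻¹ := by
  simp [sphPoint]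

lemma sphPoint_zero_pos {n : ℕ} (x : Fin n → ℝ) : 0 < sphPoint x 0 := by
  rw [sphPoint_zero]
  exact inv_pos.2 (e2_cons_one_pos x)

lemma e2_sphPoint {n : ℕ} (x : Fin n → ℝ) : e2 (sphPoint x) = 1 := by
  rw [sphPoint, e2_smul, abs_of_pos (inv_pos.2 (e2_cons_one_pos x)),
    inv_mul_cancel₀ (e2_cons_one_pos x).ne']

lemma lintegral_liftPos {n : ℕ} (p : Measure (Fin n → ℝ)) {f : (Fin (n + 1) → ℝ) → ℝ≥0∞}
    (hf : Measurable f) :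
    ∫⁻ u, f u ∂liftPos p = 2⁻¹ * ∫⁻ x, ENNReal.ofReal (e2 (Fin.cons 1 x : Fin (n + 1) → ℝ)) *
      (f (sphPoint x) + f (-sphPoint x)) ∂p := by
  rw [liftPos, lintegral_radPos _ hf, lintegral_symLift]
  · simp only [e2_neg, smul_neg, mul_add, sphPoint]
  · exact measurable_e2.ennreal_ofReal.mul (hf.comp measurable_e2_inv_smul)

lemma liftPos_add {n : ℕ} (p q : Measure (Fin n → ℝ)) :
    liftPos (p + q) = liftPos p + liftPos q := by
  refine Measure.ext_of_lintegral _ fun f hf => ?_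
  rw [lintegral_add_measure, lintegral_liftPos _ hf, lintegral_liftPos _ hf,
    lintegral_liftPos _ hf, lintegral_add_measure, mul_add]

lemma liftPos_map_neg {n : ℕ} (p : Measure (Fin n → ℝ)) :
    (liftPos p).map (fun u => -u) = liftPos p := by
  refine Measure.ext_of_lintegral _ fun f hf => ?_
  have hf' : Measurable fun u => f (-u) := hf.comp measurable_neg
  rw [lintegral_map hf measurable_neg, lintegral_liftPos _ hf', lintegral_liftPos _ hf]
  simp only [neg_neg, add_comm]

lemma measurableSet_sph_inter {n : ℕ} :
    MeasurableSet (Sph (n + 1) ∩ {u : Fin (n + 1) → ℝ | u 0 ≠ 0}) :=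
  (measurable_e2 (measurableSet_singleton 1)).inter
    (measurableSet_eq_fun (measurable_pi_apply 0) measurable_const).compl

lemma liftPos_compl_sph_inter {n : ℕ} (p : Measure (Fin n → ℝ)) :
    liftPos p (Sph (n + 1) ∩ {u | u 0 ≠ 0})ᶜ = 0 := by
  have hm := (measurableSet_sph_inter (n := n)).compl
  rw [← lintegral_indicator_one hm, lintegral_liftPos _ (measurable_one.indicator hm)]
  have h1 : ∀ x : Fin n → ℝ, sphPoint x ∈ Sph (n + 1) ∩ {u | u 0 ≠ 0} := fun x =>
    ⟨e2_sphPoint x, (sphPoint_zero_pos x).ne'⟩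
  have h2 : ∀ x : Fin n → ℝ, -sphPoint x ∈ Sph (n + 1) ∩ {u | u 0 ≠ 0} := fun x =>
    ⟨(e2_neg _).trans (e2_sphPoint x), neg_ne_zero.2 (sphPoint_zero_pos x).ne'⟩
  simp [Set.indicator_of_notMem, h1, h2]

/-- The central projection `u ↦ (u₁, …, uₙ) / u₀`. -/
def affPoint {n : ℕ} (u : Fin (n + 1) → ℝ) : Fin n → ℝ := (u 0)⁻¹ • Fin.tail u

@[fun_prop]
lemma measurable_affPoint {n : ℕ} : Measurable (affPoint (n := n)) := by
  unfold affPoint Fin.tail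
  fun_prop

lemma affPoint_sphPoint {n : ℕ} (x : Fin n → ℝ) : affPoint (sphPoint x) = x := by
  have := (e2_cons_one_pos x).ne'
  ext i
  simp [affPoint, sphPoint, Fin.tail, this]

lemma cons_one_affPoint {n : ℕ} {u : Fin (n + 1) → ℝ} (hu : u 0 ≠ 0) :
    (Fin.cons 1 (affPoint u) : Fin (n + 1) → ℝ) = (u 0)⁻¹ • u := by
  ext i
  refine Fin.cases ?_ (fun j => ?_) i
  · simp [hu]
  · simp [affPoint, Fin.tail]

lemma e2_cons_one_affPoint {n : ℕ} {u : Fin (n + 1) → ℝ} (hu : e2 u = 1) (h0 : 0 < u 0) :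
    e2 (Fin.cons 1 (affPoint u) : Fin (n + 1) → ℝ) = (u 0)⁻¹ := by
  rw [cons_one_affPoint h0.ne', e2_smul, hu, mul_one, abs_of_pos (inv_pos.2 h0)]

lemma sphPoint_affPoint {n : ℕ} {u : Fin (n + 1) → ℝ} (hu : e2 u = 1) (h0 : 0 < u 0) :
    sphPoint (affPoint u) = u := by
  rw [sphPoint, e2_cons_one_affPoint hu h0, cons_one_affPoint h0.ne', inv_inv, smul_smul,
    mul_inv_cancel₀ h0.ne', one_smul]

/-- The inverse of the lifting on non-negative measures: the image under central projection of
twice the restriction to the open upper half-space, weighted by `u₀`. -/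
def unliftPos {n : ℕ} (r : Measure (Fin (n + 1) → ℝ)) : Measure (Fin n → ℝ) :=
  (2 : ℝ≥0∞) • (r.withDensity fun u => ENNReal.ofReal (u 0)).map affPoint

lemma lintegral_unliftPos {n : ℕ} (r : Measure (Fin (n + 1) → ℝ)) {f : (Fin n → ℝ) → ℝ≥0∞}
    (hf : Measurable f) :
    ∫⁻ x, f x ∂unliftPos r = 2 * ∫⁻ u, ENNReal.ofReal (u 0) * f (affPoint u) ∂r := by
  rw [unliftPos, lintegral_smul_measure, lintegral_map hf measurable_affPoint, smul_eq_mul]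
  congr 1
  exact lintegral_withDensity_eq_lintegral_mul _ (measurable_pi_apply 0).ennreal_ofReal
    (hf.comp measurable_affPoint)

lemma unliftPos_liftPos {n : ℕ} (p : Measure (Fin n → ℝ)) : unliftPos (liftPos p) = p := by
  refine Measure.ext_of_lintegral _ fun f hf => ?_
  have hg : Measurable fun u : Fin (n + 1) → ℝ => ENNReal.ofReal (u 0) * f (affPoint u) := by
    fun_prop
  rw [lintegral_unliftPos _ hf, lintegral_liftPos _ hg, ← mul_assoc,
    ENNReal.mul_inv_cancel (by simp) (by simp), one_mul]
  refine lintegral_congr fun x => ?_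
  have h0 : ENNReal.ofReal ((-sphPoint x) 0) = 0 :=
    ENNReal.ofReal_of_nonpos (neg_nonpos.2 (sphPoint_zero_pos x).le)
  rw [h0, zero_mul, add_zero, affPoint_sphPoint, ← mul_assoc,
    ← ENNReal.ofReal_mul (e2_nonneg _), sphPoint_zero, mul_inv_cancel₀ (e2_cons_one_pos x).ne',
    ENNReal.ofReal_one, one_mul]

section Unlift

variable {n : ℕ} {r : Measure (Fin (n + 1) → ℝ)}

lemma isFiniteMeasure_unliftPos [IsFiniteMeasure r] (hr : ∀ᵐ u ∂r, e2 u = 1) :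
    IsFiniteMeasure (unliftPos r) := by
  constructor
  rw [← lintegral_one, lintegral_unliftPos _ measurable_const]
  refine ENNReal.mul_lt_top (by simp) ?_
  calc _ ≤ ∫⁻ _, 1 ∂r := lintegral_mono_ae <| hr.mono fun u hu => by
        simpa using (apply_le_e2 u 0).trans_eq hu
    _ < ⊤ := by simp

lemma finiteFirstMoment_unliftPos [IsFiniteMeasure r] (hr : ∀ᵐ u ∂r, e2 u = 1) :
    FiniteFirstMoment (unliftPos r) := by
  rw [FiniteFirstMoment, lintegral_unliftPos _ measurable_e2.ennreal_ofReal]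
  refine ENNReal.mul_lt_top (by simp) ?_
  calc _ ≤ ∫⁻ _, 1 ∂r := lintegral_mono_ae <| hr.mono fun u hu => by
        rcases le_or_gt (u 0) 0 with h0 | h0
        · simp [ENNReal.ofReal_of_nonpos h0]
        · rw [← ENNReal.ofReal_mul h0.le, ENNReal.ofReal_le_one]
          calc u 0 * e2 (affPoint u) ≤ u 0 * (u 0)⁻¹ := by
                gcongr
                exact (e2_le_e2_cons_one _).trans_eq (e2_cons_one_affPoint hu h0)
            _ = 1 := mul_inv_cancel₀ h0.ne'
    _ < ⊤ := by simp

lemma liftPos_unliftPos (hr : ∀ᵐ u ∂r, e2 u = 1) :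
    liftPos (unliftPos r) =
      r.restrict {u | 0 < u 0} + (r.restrict {u | 0 < u 0}).map (fun u => -u) := by
  have hH : MeasurableSet {u : Fin (n + 1) → ℝ | 0 < u 0} :=
    measurable_pi_apply 0 measurableSet_Ioi
  refine Measure.ext_of_lintegral _ fun f hf => ?_
  have hf' : Measurable fun u => f (-u) := hf.comp measurable_neg
  have hg : Measurable fun x : Fin n → ℝ =>
      ENNReal.ofReal (e2 (Fin.cons 1 x : Fin (n + 1) → ℝ)) * (f (sphPoint x) + f (-sphPoint x)) :=
    (measurable_e2.comp measurable_cons_one).ennreal_ofReal.mul (by fun_prop)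
  rw [lintegral_add_measure, lintegral_map hf measurable_neg, ← lintegral_add_left hf,
    lintegral_liftPos _ hf, lintegral_unliftPos _ hg, ← mul_assoc,
    ENNReal.inv_mul_cancel (by simp) (by simp), one_mul, ← lintegral_indicator hH]
  refine lintegral_congr_ae (hr.mono fun u hu => ?_)
  rcases le_or_gt (u 0) 0 with h0 | h0
  · simp [ENNReal.ofReal_of_nonpos h0, h0]
  · have hu0 : u ∈ {u : Fin (n + 1) → ℝ | 0 < u 0} := h0
    simp only [Set.indicator_of_mem hu0, sphPoint_affPoint hu h0, e2_cons_one_affPoint hu h0]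
    rw [← mul_assoc, ← ENNReal.ofReal_mul h0.le, mul_inv_cancel₀ h0.ne', ENNReal.ofReal_one,
      one_mul]

end Unlift

lemma toSigned_restrict_add_map_neg_apply {n : ℕ} (r : Measure (Fin (n + 1) → ℝ))
    [IsFiniteMeasure r] {s : Set (Fin (n + 1) → ℝ)} (hs : MeasurableSet s) :
    toSigned (r.restrict {u | 0 < u 0} + (r.restrict {u | 0 < u 0}).map (fun u => -u)) s =
      r.real (s ∩ {u | 0 < u 0}) + r.real ((fun u => -u) ⁻¹' s ∩ {u | 0 < u 0}) := by
  rw [toSigned_eq, Measure.toSignedMeasure_apply_measurable hs, measureReal_add_apply,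
    measureReal_restrict_apply hs, map_measureReal_apply (f := fun u => -u) measurable_neg hs,
    measureReal_restrict_apply (measurable_neg hs)]

lemma ConcOn.apply_eq_of_even {n : ℕ} {ρ : SM (n + 1)}
    (hc : ConcOn ρ (Sph (n + 1) ∩ {u | u 0 ≠ 0})) (he : ρ.map (fun x => -x) = ρ)
    {s : Set (Fin (n + 1) → ℝ)} (hs : MeasurableSet s) :
    ρ s = ρ (s ∩ {u | 0 < u 0}) + ρ ((fun u => -u) ⁻¹' s ∩ {u | 0 < u 0}) := by
  have hH : MeasurableSet {u : Fin (n + 1) → ℝ | 0 < u 0} :=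
    measurable_pi_apply 0 measurableSet_Ioi
  have hH' : MeasurableSet {u : Fin (n + 1) → ℝ | u 0 < 0} :=
    measurable_pi_apply 0 measurableSet_Iio
  have hneg : ρ ((fun u => -u) ⁻¹' s ∩ {u | 0 < u 0}) = ρ (s ∩ {u | u 0 < 0}) := by
    conv_rhs => rw [← he]
    rw [VectorMeasure.map_apply _ (f := fun u => -u) measurable_neg (hs.inter hH')]
    congr 1
    ext u
    simp
  have hzero : ρ ((s \ {u | 0 < u 0}) \ (s ∩ {u | u 0 < 0})) = 0 := by
    refine ρ.null_of_totalVariation_zero (measure_mono_null ?_ hc)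
    rintro u ⟨⟨hus, h1⟩, h2⟩ ⟨-, h0⟩
    exact h0 (le_antisymm (not_lt.1 h1) (not_lt.1 fun h => h2 ⟨hus, h⟩))
  have hsub : s ∩ {u : Fin (n + 1) → ℝ | u 0 < 0} ⊆ s \ {u | 0 < u 0} :=
    fun u hu => ⟨hu.1, lt_asymm (show u 0 < 0 from hu.2)⟩
  have h1 := VectorMeasure.of_add_of_sdiff (v := ρ) (hs.inter hH) hs Set.inter_subset_left
  have h2 := VectorMeasure.of_add_of_sdiff (v := ρ)
    (hs.inter hH') (hs.diff hH) hsub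
  rw [Set.sdiff_self_inter] at h1
  rw [hneg, ← h1, ← h2, hzero, add_zero]

lemma IntegrableSM.finiteFirstMoment_posPart {n : ℕ} {μ : SM n} (h : IntegrableSM μ) :
    FiniteFirstMoment μ.toJordanDecomposition.posPart :=
  FiniteFirstMoment.mono (Measure.le_add_right le_rfl) h

lemma IntegrableSM.finiteFirstMoment_negPart {n : ℕ} {μ : SM n} (h : IntegrableSM μ) :
    FiniteFirstMoment μ.toJordanDecomposition.negPart :=
  FiniteFirstMoment.mono (Measure.le_add_left le_rfl) h

lemma IntegrableSM.Lift_eq {n : ℕ} {μ : SM n} (h : IntegrableSM μ) :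
    Lift μ = toSigned (liftPos μ.toJordanDecomposition.posPart) -
      toSigned (liftPos μ.toJordanDecomposition.negPart) := by
  conv_lhs => rw [← toSigned_toJordanDecomposition μ]
  exact Lift_toSigned_sub h.finiteFirstMoment_posPart h.finiteFirstMoment_negPart

lemma IntegrableSM.Lift_mem {n : ℕ} {μ : SM n} (h : IntegrableSM μ) :
    ConcOn (Lift μ) (Sph (n + 1) ∩ {u | u 0 ≠ 0}) ∧ (Lift μ).map (fun x => -x) = Lift μ := by
  have := h.finiteFirstMoment_posPart.isFiniteMeasure_liftPos
  have := h.finiteFirstMoment_negPart.isFiniteMeasure_liftPos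
  rw [h.Lift_eq]
  constructor
  · refine le_antisymm ((totalVariation_toSigned_sub_le _ _ _).trans_eq ?_) zero_le
    simp only [Measure.add_apply, liftPos_compl_sph_inter, add_zero]
  · rw [toSigned_sub_map _ _ measurable_neg, liftPos_map_neg, liftPos_map_neg]

lemma Lift_injOn {n : ℕ} : Set.InjOn (Lift (n := n)) {μ : SM n | IntegrableSM μ} := by
  intro μ (hμ : IntegrableSM μ) ν (hν : IntegrableSM ν) h
  have := hμ.finiteFirstMoment_posPart.isFiniteMeasure_liftPos
  have := hμ.finiteFirstMoment_negPart.isFiniteMeasure_liftPos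
  have := hν.finiteFirstMoment_posPart.isFiniteMeasure_liftPos
  have := hν.finiteFirstMoment_negPart.isFiniteMeasure_liftPos
  rw [hμ.Lift_eq, hν.Lift_eq, toSigned_sub_eq_toSigned_sub_iff, ← liftPos_add,
    ← liftPos_add] at h
  rw [← toSigned_toJordanDecomposition μ, ← toSigned_toJordanDecomposition ν,
    toSigned_sub_eq_toSigned_sub_iff]
  exact Function.LeftInverse.injective unliftPos_liftPos h

lemma exists_integrableSM_Lift_eq {n : ℕ} {ρ : SM (n + 1)}
    (hc : ConcOn ρ (Sph (n + 1) ∩ {u | u 0 ≠ 0})) (he : ρ.map (fun x => -x) = ρ) :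
    ∃ μ : SM n, IntegrableSM μ ∧ Lift μ = ρ := by
  set r := ρ.toJordanDecomposition.posPart
  set t := ρ.toJordanDecomposition.negPart
  have hae : ∀ᵐ u ∂ρ.totalVariation, e2 u = 1 :=
    measure_mono_null (Set.compl_subset_compl.2 Set.inter_subset_left) hc
  have hr : ∀ᵐ u ∂r, e2 u = 1 := ae_mono (Measure.le_add_right le_rfl) hae
  have ht : ∀ᵐ u ∂t, e2 u = 1 := ae_mono (Measure.le_add_left le_rfl) hae
  have := isFiniteMeasure_unliftPos hr
  have := isFiniteMeasure_unliftPos ht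
  have hr' := finiteFirstMoment_unliftPos hr
  have ht' := finiteFirstMoment_unliftPos ht
  refine ⟨toSigned (unliftPos r) - toSigned (unliftPos t),
    (hr'.add ht').mono (totalVariation_toSigned_sub_le _ _), ?_⟩
  rw [Lift_toSigned_sub hr' ht', liftPos_unliftPos hr, liftPos_unliftPos ht]
  have hH : MeasurableSet {u : Fin (n + 1) → ℝ | 0 < u 0} :=
    measurable_pi_apply 0 measurableSet_Ioi
  ext s hs
  rw [_root_.sub_apply, toSigned_restrict_add_map_neg_apply r hs,
    toSigned_restrict_add_map_neg_apply t hs, hc.apply_eq_of_even he hs,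
    ρ.apply_eq_posPart_real_sub_negPart_real (hs.inter hH),
    ρ.apply_eq_posPart_real_sub_negPart_real ((measurable_neg hs).inter hH)]
  ring

/-- Theorem: the lifting `L` is a bijection from the integrable signed measures on `ℝⁿ`
onto the origin-symmetric measures concentrated on `S^n_0 = {u ∈ Sⁿ : u₀ ≠ 0}`. -/
theorem stmt18 {n : ℕ} (hn : 1 ≤ n) :
    Set.BijOn (Lift (n := n)) {μ : SM n | IntegrableSM μ}
      {ρ : SM (n + 1) | ConcOn ρ (Sph (n + 1) ∩ {u | u 0 ≠ 0}) ∧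
        ρ.map (fun x => -x) = ρ} := by
  exact ⟨fun _ h => IntegrableSM.Lift_mem h, Lift_injOn,
    fun _ h => exists_integrableSM_Lift_eq h.1 h.2⟩

end
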